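/- arXiv:2410.04394 — 3 statements merged into one kernel-verified Lean document; each statement's English description precedes it below -/
import Mathlib

section
/- Let d ≥ 3 be an integer, let α, ε ∈ (0,1], L ≥ 1, and let G be a d-regular simple graph on [n] satisfying the long-range expansion property Expan(α,ε,L). Let k ≥ 1 and let f : [n] → {−1,0,1}^k satisfy min{|{v ∈ [n] : f(v)_j ≥ 0}|, |{v ∈ [n] : f(v)_j ≤ 0}|} ≥ n/2 for every j ∈ [k]. Set L̃ := 2·(20·d·L/(α·ε))^8. Let j ∈ [k], let ℓ ≥ 1 be an integer, and let σ ∈ {+,−} be such that V_σ(j;ℓ) is nonempty. Then there exists for each v ∈ V_σ(j;ℓ) a subset Ẽ(v,j) ⊆ E(v,j;ℓ) such that: (i) |Ẽ(v,j)| ≥ (α·a_ℓ/12)·(d−1)^{ℓ−1} for every v ∈ V_σ(j;ℓ); and (ii) for every e ∈ E_G, |{v ∈ V_σ(j;ℓ) : e ∈ Ẽ(v,j)}| ≤ L̃·(d−1−ε)^ℓ. -/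
open Finset

attribute [local instance] Classical.propDecidable

noncomputable section

/-- Distance (in `ℕ∞`) from a vertex to a finite set of vertices. -/
def vertexSetDist {n : ℕ} (G : SimpleGraph (Fin n)) (v : Fin n) (S : Finset (Fin n)) : ℕ∞ :=
  S.inf fun w => G.edist v w

/-- Distance (in `ℕ∞`) from a vertex to an (unordered) edge. -/
def edgeDist {n : ℕ} (G : SimpleGraph (Fin n)) (v : Fin n) (e : Sym2 (Fin n)) : ℕ∞ :=
  Sym2.lift ⟨fun a b => min (G.edist v a) (G.edist v b), fun _ _ => min_comm _ _⟩ e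

/-- Distance (in `ℕ∞`) from an (unordered) edge to a finite set of vertices. -/
def edgeSetDist {n : ℕ} (G : SimpleGraph (Fin n)) (e : Sym2 (Fin n)) (S : Finset (Fin n)) : ℕ∞ :=
  S.inf fun v => edgeDist G v e

/-- Part (A) of the long-range expansion property. -/
def ExpanA (n d : ℕ) (G : SimpleGraph (Fin n)) (α : ℝ) : Prop :=
  ∀ S : Finset (Fin n), S.Nonempty → ∀ ℓ : ℕ, 1 ≤ ℓ →
    min (3 * (n : ℝ) / 4) (α * ((d : ℝ) - 1) ^ ℓ * S.card) ≤
      ((univ.filter fun v => vertexSetDist G v S ≤ (ℓ : ℕ∞)).card : ℝ)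

/-- Part (B) of the long-range expansion property. -/
def ExpanB (n d : ℕ) (G : SimpleGraph (Fin n)) [DecidableRel G.Adj] (α ε L : ℝ) : Prop :=
  ∀ S : Finset (Fin n), S.Nonempty → ∀ ℓ : ℕ, 1 ≤ ℓ →
    α * ((d : ℝ) - 1) ^ (ℓ - 1) * S.card ≤ 3 * n / 4 →
    ∃ v ∈ S,
      (((G.edgeFinset.filter fun e =>
            L * ((d : ℝ) - 1 - ε) ^ ℓ ≤
              ((S.filter fun u => edgeDist G u e ≤ ((ℓ - 1 : ℕ) : ℕ∞)).card : ℝ)).filter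
          fun e => edgeDist G v e ≤ ((ℓ - 1 : ℕ) : ℕ∞)).card : ℝ) ≤
        L * ((d : ℝ) - 1 - ε) ^ ℓ

/-- The long-range expansion property `Expan(α, ε, L)`. -/
def Expan (n d : ℕ) (G : SimpleGraph (Fin n)) [DecidableRel G.Adj] (α ε L : ℝ) : Prop :=
  ExpanA n d G α ∧ ExpanB n d G α ε L

/-- `N` is a norm on `ℝ^k`. -/
def IsNorm (k : ℕ) (N : (Fin k → ℝ) → ℝ) : Prop :=
  (∀ x, N x = 0 ↔ x = 0) ∧ (∀ (c : ℝ) (x), N (c • x) = |c| * N x) ∧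
    ∀ x y, N (x + y) ≤ N x + N y

/-- The standard basis of `ℝ^k` is `K`-unconditional for `N`. -/
def UncondConst (k : ℕ) (N : (Fin k → ℝ) → ℝ) (K : ℝ) : Prop :=
  ∀ (σ : Fin k → Bool) (a : Fin k → ℝ),
    N (fun j => (if σ j then (1 : ℝ) else -1) * a j) ≤ K * N a

/-- `N` is a `1`-unconditional norm on `ℝ^k`: `‖y‖ = ‖|y|‖`. -/
def OneUnconditional (k : ℕ) (N : (Fin k → ℝ) → ℝ) : Prop :=
  ∀ y, N y = N fun j => |y j|

/-- `N` has cotype `q` with constant `C`. -/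
def HasCotype (k : ℕ) (N : (Fin k → ℝ) → ℝ) (q C : ℝ) : Prop :=
  ∀ (m : ℕ) (x : Fin m → Fin k → ℝ),
    1 / C ^ q * ∑ i, N (x i) ^ q ≤
      1 / 2 ^ m * ∑ σ : Fin m → Bool, N (∑ i, (if σ i then (1 : ℝ) else -1) • x i) ^ q

/-- The collection of vectors `Y` has restricted cotype `q` with constant `C` w.r.t. `N`. -/
def RestrictedCotype (k : ℕ) (N : (Fin k → ℝ) → ℝ) (q C : ℝ) (Y : Set (Fin k → ℝ)) : Prop :=
  ∀ (m : ℕ), 0 < m → ∀ y : Fin m → Fin k → ℝ, Function.Injective y → (∀ i, y i ∈ Y) →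
    1 / C ^ q * ∑ i, N (y i) ^ q ≤
      1 / 2 ^ m * ∑ σ : Fin m → Bool, N (∑ i, (if σ i then (1 : ℝ) else -1) • y i) ^ q

/-- For an edge `e = {a, b}`, the value `N (f a - f b)` (well-defined when `N` is a norm). -/
def edgeNorm {n k : ℕ} (N : (Fin k → ℝ) → ℝ) (f : Fin n → Fin k → ℝ) (e : Sym2 (Fin n)) : ℝ :=
  Sym2.lift ⟨fun a b => min (N (f a - f b)) (N (f b - f a)), fun _ _ => min_comm _ _⟩ e

/-- Coordinate projection `P_J`. -/
def proj {k : ℕ} (J : Finset (Fin k)) (y : Fin k → ℝ) : Fin k → ℝ :=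
  fun j => if j ∈ J then y j else 0

/-- Indicator vector `χ_J ∈ ℝ^k`. -/
def chi {k : ℕ} (J : Finset (Fin k)) : Fin k → ℝ := fun j => if j ∈ J then 1 else 0

/-- The sequence `a_ℓ = (6/π²) ℓ⁻²`. -/
def aseq (ℓ : ℕ) : ℝ := 6 / Real.pi ^ 2 * (1 / (ℓ : ℝ) ^ 2)

/-- The set of edges `E(S, j; ℓ)`: edges within distance `ℓ - 1` of `S` with a jump in the
`j`-th coordinate. -/
def jumpEdges {n k : ℕ} (G : SimpleGraph (Fin n)) [DecidableRel G.Adj]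
    (f : Fin n → Fin k → ℝ) (j : Fin k) (S : Finset (Fin n)) (ℓ : ℕ) :
    Finset (Sym2 (Fin n)) :=
  G.edgeFinset.filter fun e =>
    edgeSetDist G e S ≤ ((ℓ - 1 : ℕ) : ℕ∞) ∧
      Sym2.lift ⟨fun a b => f a j ≠ f b j, fun _ _ => propext ne_comm⟩ e

/-- The scale `ℓ_{v,j}`. -/
def lvj {n k : ℕ} (G : SimpleGraph (Fin n)) [DecidableRel G.Adj]
    (f : Fin n → Fin k → ℝ) (α : ℝ) (d : ℕ) (v : Fin n) (j : Fin k) : ℕ :=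
  sInf {ℓ : ℕ | 1 ≤ ℓ ∧
    α * aseq ℓ / 6 * ((d : ℝ) - 1) ^ (ℓ - 1) ≤ ((jumpEdges G f j {v} ℓ).card : ℝ)}

/-- The set `V_+(j; ℓ)`. -/
def Vplus {n k : ℕ} (G : SimpleGraph (Fin n)) [DecidableRel G.Adj]
    (f : Fin n → Fin k → ℝ) (α : ℝ) (d : ℕ) (j : Fin k) (ℓ : ℕ) : Finset (Fin n) :=
  univ.filter fun v => f v j = 1 ∧ lvj G f α d v j = ℓ

/-- The set `V_-(j; ℓ)`. -/
def Vminus {n k : ℕ} (G : SimpleGraph (Fin n)) [DecidableRel G.Adj]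
    (f : Fin n → Fin k → ℝ) (α : ℝ) (d : ℕ) (j : Fin k) (ℓ : ℕ) : Finset (Fin n) :=
  univ.filter fun v => f v j = -1 ∧ lvj G f α d v j = ℓ

/-- The scale-`ℓ` support `J(v, ℓ)`. -/
def Jset {n k : ℕ} (G : SimpleGraph (Fin n)) [DecidableRel G.Adj]
    (f : Fin n → Fin k → ℝ) (α : ℝ) (d : ℕ) (v : Fin n) (ℓ : ℕ) : Finset (Fin k) :=
  univ.filter fun j => f v j ≠ 0 ∧ lvj G f α d v j = ℓ

/-- The scale-`ℓ` mutual support `J(v, ℓ, e)`, relative to a family `Ẽ(v, j)` of edge sets. -/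
def JsetE {n k : ℕ} (G : SimpleGraph (Fin n)) [DecidableRel G.Adj]
    (f : Fin n → Fin k → ℝ) (α : ℝ) (d : ℕ) (Et : Fin n → Fin k → Finset (Sym2 (Fin n)))
    (v : Fin n) (ℓ : ℕ) (e : Sym2 (Fin n)) : Finset (Fin k) :=
  (Jset G f α d v ℓ).filter fun j => e ∈ Et v j

end
/-- vertices reachable from the dart `(p,q)` by non-backtracking walks of length at most `m`. -/
noncomputable def NB {n : ℕ} (G : SimpleGraph (Fin n)) : ℕ → Fin n → Fin n → Finset (Fin n)
  | 0, _, q => {q}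
  | m + 1, p, q => {q} ∪ ((univ.filter fun x => G.Adj q x).erase p).biUnion fun x => NB G m q x

lemma NB_card {n d : ℕ} (hd : 3 ≤ d) (G : SimpleGraph (Fin n)) [DecidableRel G.Adj]
    (hreg : ∀ v, G.degree v = d) (m : ℕ) : ∀ p q, G.Adj p q →
    (NB G m p q).card + 1 ≤ 2 * (d - 1) ^ m := by
  induction m with
  | zero => intro p q _; simp [NB]
  | succ m ih =>
    intro p q hpq
    have h1 : ((univ.filter fun x => G.Adj q x).erase p).card = d - 1 := by
      rw [Finset.card_erase_of_mem (by simp [hpq.symm]), ← hreg q, ← G.card_neighborFinset_eq_degree]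
      congr 2
      ext x; simp
    have h2 : (((univ.filter fun x => G.Adj q x).erase p).biUnion fun x => NB G m q x).card
        ≤ (d - 1) * (2 * (d - 1) ^ m - 1) := by
      rw [← h1]
      apply Finset.card_biUnion_le_card_mul
      intro x hx
      rw [h1]
      have := ih q x (by simpa using (Finset.mem_erase.1 hx).2)
      omega
    have h3 : (NB G (m + 1) p q).card ≤ 1 +
        (((univ.filter fun x => G.Adj q x).erase p).biUnion fun x => NB G m q x).card := by
      rw [NB]
      refine (Finset.card_union_le _ _).trans ?_
      rw [Finset.card_singleton]
      apply le_of_eq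
      congr!
    obtain ⟨c, rfl⟩ : ∃ c, d = c + 3 := ⟨d - 3, by omega⟩
    have h4 : 1 ≤ (c + 3 - 1) ^ m := Nat.one_le_pow _ _ (by omega)
    simp only [show c + 3 - 1 = c + 2 by omega] at *
    rw [Nat.mul_sub] at h2
    have h5 : (c+2) * 1 ≤ (c + 2) * (2 * (c + 2) ^ m) := Nat.mul_le_mul_left _ (by omega)
    have h6 : 2 * (c + 2) ^ (m + 1) = (c + 2) * (2 * (c + 2) ^ m) := by ring
    omega

lemma mem_NB {n : ℕ} (G : SimpleGraph (Fin n)) {q w : Fin n} (P : G.Walk q w) :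
    ∀ (p : Fin n) (m : ℕ), P.IsPath → p ∉ P.support → P.length ≤ m → w ∈ NB G m p q := by
  induction P with
  | nil => intro p m _ _ _; cases m <;> simp [NB]
  | @cons q x w h P' ih =>
    intro p m hP hp hm
    cases m with
    | zero => simp at hm
    | succ m =>
      rw [SimpleGraph.Walk.cons_isPath_iff] at hP
      simp only [NB, Finset.mem_union, Finset.mem_biUnion]
      right
      refine ⟨x, ?_, ih q m hP.1 hP.2 (by simpa using hm)⟩
      simp only [SimpleGraph.Walk.support_cons, List.mem_cons, not_or] at hp
      rw [Finset.mem_erase]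
      refine ⟨?_, by simpa using h⟩
      rintro rfl
      exact hp.2 (SimpleGraph.Walk.start_mem_support _)

lemma exists_path {n : ℕ} (G : SimpleGraph (Fin n)) {v w : Fin n} {r : ℕ}
    (h : G.edist v w ≤ r) : ∃ P : G.Walk v w, P.IsPath ∧ P.length ≤ r := by
  have hne : G.edist v w ≠ ⊤ := fun h' => by rw [h'] at h; simp at h
  obtain ⟨P, hP⟩ := SimpleGraph.exists_walk_of_edist_ne_top hne
  refine ⟨P.bypass, P.bypass_isPath, le_trans P.length_bypass_le_length ?_⟩
  rw [← hP] at h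
  exact_mod_cast h

lemma path_jump {n : ℕ} (G : SimpleGraph (Fin n)) (g : Fin n → Prop) {v w : Fin n}
    (P : G.Walk v w) : ∀ r : ℕ, P.IsPath → P.length ≤ r → g v → ¬ g w →
    ∃ i < r, ∃ p q, G.Adj p q ∧ g p ∧ ¬ g q ∧ G.edist v p ≤ i ∧ w ∈ NB G (r - 1 - i) p q := by
  induction P with
  | nil => intro r _ _ h1 h2; exact absurd h1 h2
  | @cons v u w h P' ih =>
    intro r hP hr hv hw
    rw [SimpleGraph.Walk.cons_isPath_iff] at hP
    rw [SimpleGraph.Walk.length_cons] at hr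
    by_cases hu : g u
    · obtain ⟨i, hi, p, q, hpq, hp, hq, hd, hm⟩ := ih (r - 1) hP.1 (by omega) hu hw
      refine ⟨i + 1, by omega, p, q, hpq, hp, hq, ?_, ?_⟩
      · calc G.edist v p ≤ G.edist v u + G.edist u p := SimpleGraph.edist_triangle
          _ ≤ 1 + i := add_le_add (SimpleGraph.edist_eq_one_iff_adj.2 h).le hd
          _ = _ := by push_cast; rw [add_comm]
      · convert hm using 2; omega
    · refine ⟨0, by omega, v, u, h, hv, hu, by simp, ?_⟩
      exact mem_NB G P' v _ hP.1 hP.2 (by omega)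

lemma ball_card {n d : ℕ} (hd : 3 ≤ d) (G : SimpleGraph (Fin n)) [DecidableRel G.Adj]
    (hreg : ∀ v, G.degree v = d) (m : ℕ) (a : Fin n) :
    (univ.filter fun v => G.edist v a ≤ m).card ≤ d * (2 * (d - 1) ^ m) := by
  have hsub : (univ.filter fun v => G.edist v a ≤ m) ⊆
      {a} ∪ (G.neighborFinset a).biUnion fun x => NB G m a x := by
    intro v hv
    rw [Finset.mem_filter, SimpleGraph.edist_comm] at hv
    obtain ⟨P, hP, hl⟩ := exists_path G hv.2
    cases P with
    | nil => simp
    | @cons _ x _ h P' =>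
      rw [SimpleGraph.Walk.cons_isPath_iff] at hP
      rw [SimpleGraph.Walk.length_cons] at hl
      rw [Finset.mem_union]; right
      rw [Finset.mem_biUnion]
      exact ⟨x, by simpa using h, mem_NB G P' a m hP.1 hP.2 (by omega)⟩
  refine (Finset.card_le_card hsub).trans ((Finset.card_union_le _ _).trans ?_)
  have h2 : ((G.neighborFinset a).biUnion fun x => NB G m a x).card ≤ d * (2 * (d-1)^m - 1) := by
    rw [← hreg a, ← G.card_neighborFinset_eq_degree a]
    apply Finset.card_biUnion_le_card_mul
    intro x hx
    have := NB_card hd G hreg m a x (by simpa using hx)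
    rw [G.card_neighborFinset_eq_degree, hreg]
    omega
  have h4 : 1 ≤ (d - 1) ^ m := Nat.one_le_pow _ _ (by omega)
  have h5 : d * 1 ≤ d * (2 * (d - 1) ^ m) := Nat.mul_le_mul_left _ (by omega)
  rw [Nat.mul_sub] at h2
  rw [Finset.card_singleton]
  omega

lemma edge_ball_card {n d : ℕ} (hd : 3 ≤ d) (G : SimpleGraph (Fin n)) [DecidableRel G.Adj]
    (hreg : ∀ v, G.degree v = d) (m : ℕ) (e : Sym2 (Fin n)) :
    (univ.filter fun v => edgeDist G v e ≤ m).card ≤ 4 * d * (d - 1) ^ m := by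
  induction e with
  | _ a b =>
    have hsub : (univ.filter fun v => edgeDist G v s(a, b) ≤ m) ⊆
        (univ.filter fun v => G.edist v a ≤ m) ∪ (univ.filter fun v => G.edist v b ≤ m) := by
      intro v hv
      simpa [edgeDist] using hv
    refine (Finset.card_le_card hsub).trans ((Finset.card_union_le _ _).trans ?_)
    have := ball_card hd G hreg m a
    have := ball_card hd G hreg m b
    have : 4 * d * (d - 1) ^ m = d * (2 * (d - 1) ^ m) + d * (2 * (d - 1) ^ m) := by ring
    omega

lemma aseq_sum (r : ℕ) : ∑ i ∈ range r, aseq (i + 1) ≤ 1 := by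
  have h := hasSum_zeta_two
  have h0 : ∀ i : ℕ, 0 ≤ (1 : ℝ) / (i : ℝ) ^ 2 := fun i => by positivity
  have h1 : ∑ i ∈ range (r + 1), (1 : ℝ) / (i : ℝ) ^ 2 ≤ Real.pi ^ 2 / 6 :=
    sum_le_hasSum _ (fun i _ => h0 i) h
  rw [Finset.sum_range_succ'] at h1
  simp only [aseq]
  rw [← Finset.mul_sum]
  have hp : 0 < Real.pi ^ 2 := by positivity
  simp only [Nat.cast_zero, ne_eq, OfNat.ofNat_ne_zero, not_false_eq_true, zero_pow, div_zero,
    add_zero] at h1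
  calc 6 / Real.pi ^ 2 * ∑ i ∈ range r, 1 / ((i + 1 : ℕ) : ℝ) ^ 2
      ≤ 6 / Real.pi ^ 2 * (Real.pi ^ 2 / 6) := by gcongr
    _ = 1 := by field_simp

/-- the region behind an oriented jump edge -/
noncomputable def Treg {n : ℕ} (G : SimpleGraph (Fin n)) (g : Fin n → Prop) (m : ℕ) (e : Sym2 (Fin n)) :
    Finset (Fin n) :=
  univ.filter fun w => ∃ p q, G.Adj p q ∧ e = s(p, q) ∧ g p ∧ ¬ g q ∧ w ∈ NB G m p q

lemma Treg_card {n d : ℕ} (hd : 3 ≤ d) (G : SimpleGraph (Fin n)) [DecidableRel G.Adj]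
    (hreg : ∀ v, G.degree v = d) (g : Fin n → Prop) (m : ℕ) (e : Sym2 (Fin n)) :
    (Treg G g m e).card ≤ 2 * (d - 1) ^ m := by
  by_cases h : ∃ p q, G.Adj p q ∧ e = s(p, q) ∧ g p ∧ ¬ g q
  · obtain ⟨p, q, hpq, rfl, hp, hq⟩ := h
    have hsub : Treg G g m s(p, q) ⊆ NB G m p q := by
      intro w hw
      simp only [Treg, Finset.mem_filter] at hw
      obtain ⟨_, p', q', _, he, hp', hq', hw⟩ := hw
      rw [Sym2.eq_iff] at he
      rcases he with ⟨rfl, rfl⟩ | ⟨rfl, rfl⟩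
      · exact hw
      · exact absurd hp' hq
    have := NB_card hd G hreg m p q hpq
    have := Finset.card_le_card hsub
    omega
  · have : Treg G g m e = ∅ := by
      apply Finset.eq_empty_of_forall_notMem
      intro w hw
      simp only [Treg, Finset.mem_filter] at hw
      obtain ⟨_, p', q', h1, h2, h3, h4, _⟩ := hw
      exact h ⟨p', q', h1, h2, h3, h4⟩
    simp [this]

lemma cover {n d k : ℕ} (hd : 3 ≤ d) (α : ℝ) (hα : 0 < α)
    (G : SimpleGraph (Fin n)) [DecidableRel G.Adj]
    (hreg : ∀ v, G.degree v = d) (f : Fin n → Fin k → ℝ) (j : Fin k) (c : ℝ)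
    (S : Finset (Fin n)) (hS : ∀ v ∈ S, f v j = c) (hne : S.Nonempty) (r : ℕ) (hr : 1 ≤ r)
    (hE : ∀ v ∈ S, ∀ i < r, ((jumpEdges G f j {v} (i + 1)).card : ℝ) ≤
      α * aseq (i + 1) / 6 * ((d : ℝ) - 1) ^ i) :
    (((univ.filter fun w => vertexSetDist G w S ≤ (r : ℕ∞)) ∩
      (univ.filter fun w => f w j ≠ c)).card : ℝ) ≤ α * ((d : ℝ) - 1) ^ (r - 1) * S.card / 3 := by
  have hsub : (univ.filter fun w => vertexSetDist G w S ≤ (r : ℕ∞)) ∩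
      (univ.filter fun w => f w j ≠ c) ⊆
      S.biUnion fun v => (range r).biUnion fun i => (jumpEdges G f j {v} (i + 1)).biUnion
        fun e => Treg G (fun v => f v j = c) (r - 1 - i) e := by
    intro w hw
    simp only [Finset.mem_inter, Finset.mem_filter, Finset.mem_univ, true_and] at hw
    obtain ⟨hw1, hw2⟩ := hw
    obtain ⟨v, hv, hvd⟩ := Finset.exists_mem_eq_inf S hne (fun x => G.edist w x)
    rw [vertexSetDist, hvd, SimpleGraph.edist_comm] at hw1
    obtain ⟨P, hP, hl⟩ := exists_path G hw1
    obtain ⟨i, hi, p, q, hpq, hp, hq, hdist, hm⟩ :=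
      path_jump G (fun v => f v j = c) P r hP hl (hS v hv) hw2
    simp only [Finset.mem_biUnion]
    refine ⟨v, hv, i, by simpa using hi, s(p, q), ?_, ?_⟩
    · simp only [jumpEdges, Finset.mem_filter, SimpleGraph.mem_edgeFinset, SimpleGraph.mem_edgeSet,
        edgeSetDist, Finset.inf_singleton, edgeDist, Sym2.lift_mk]
      refine ⟨hpq, ?_, ?_⟩
      · exact min_le_of_left_le (by simpa using hdist)
      · rw [hp]; exact fun h => hq h.symm
    · simp only [Treg, Finset.mem_filter, Finset.mem_univ, true_and]
      exact ⟨p, q, hpq, rfl, hp, hq, hm⟩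
  have hd1 : (0 : ℝ) < (d : ℝ) - 1 := by
    have : (3 : ℝ) ≤ d := by exact_mod_cast hd
    linarith
  have hcast : ((d - 1 : ℕ) : ℝ) = (d : ℝ) - 1 := by
    rw [Nat.cast_sub (by omega)]; simp
  have hv : ∀ v ∈ S, (((range r).biUnion fun i => (jumpEdges G f j {v} (i + 1)).biUnion
        fun e => Treg G (fun v => f v j = c) (r - 1 - i) e).card : ℝ) ≤
        α * ((d : ℝ) - 1) ^ (r - 1) / 3 := by
    intro v hv
    have h1 : ∀ i ∈ range r, (((jumpEdges G f j {v} (i + 1)).biUnion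
        fun e => Treg G (fun v => f v j = c) (r - 1 - i) e).card : ℝ) ≤
        α * ((d : ℝ) - 1) ^ (r - 1) / 3 * aseq (i + 1) := by
      intro i hi
      rw [Finset.mem_range] at hi
      have h2 := Finset.card_biUnion_le_card_mul (jumpEdges G f j {v} (i + 1))
        (fun e => Treg G (fun v => f v j = c) (r - 1 - i) e) _
        (fun e _ => Treg_card hd G hreg _ _ e)
      have h3 : (((jumpEdges G f j {v} (i + 1)).biUnion
        fun e => Treg G (fun v => f v j = c) (r - 1 - i) e).card : ℝ) ≤
          (jumpEdges G f j {v} (i + 1)).card * (2 * ((d : ℝ) - 1) ^ (r - 1 - i)) := by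
        rw [← hcast]; exact_mod_cast h2
      refine h3.trans ?_
      have h4 := mul_le_mul_of_nonneg_right (hE v hv i hi)
        (show 0 ≤ 2 * ((d : ℝ) - 1) ^ (r - 1 - i) by positivity)
      refine h4.trans (le_of_eq ?_)
      have h5 : ((d : ℝ) - 1) ^ (r - 1) = ((d : ℝ) - 1) ^ i * ((d : ℝ) - 1) ^ (r - 1 - i) := by
        rw [← pow_add]; congr 1; omega
      rw [h5]; ring
    have h6 : (((range r).biUnion fun i => (jumpEdges G f j {v} (i + 1)).biUnion
        fun e => Treg G (fun v => f v j = c) (r - 1 - i) e).card : ℝ) ≤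
        ∑ i ∈ range r, (((jumpEdges G f j {v} (i + 1)).biUnion
        fun e => Treg G (fun v => f v j = c) (r - 1 - i) e).card : ℝ) := by
      exact_mod_cast Finset.card_biUnion_le
    refine h6.trans ((Finset.sum_le_sum h1).trans ?_)
    rw [← Finset.mul_sum]
    exact mul_le_of_le_one_right (by positivity) (aseq_sum r)
  have h7 : (((univ.filter fun w => vertexSetDist G w S ≤ (r : ℕ∞)) ∩
      (univ.filter fun w => f w j ≠ c)).card : ℝ) ≤
      ∑ v ∈ S, (((range r).biUnion fun i => (jumpEdges G f j {v} (i + 1)).biUnion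
        fun e => Treg G (fun v => f v j = c) (r - 1 - i) e).card : ℝ) := by
    exact_mod_cast (Finset.card_le_card hsub).trans Finset.card_biUnion_le
  refine h7.trans ((Finset.sum_le_sum hv).trans (le_of_eq ?_))
  rw [Finset.sum_const, nsmul_eq_mul]; ring

lemma small_S {n d k : ℕ} (hd : 3 ≤ d) (α : ℝ) (hα : 0 < α) (hα1 : α ≤ 1)
    (G : SimpleGraph (Fin n)) [DecidableRel G.Adj]
    (hreg : ∀ v, G.degree v = d) (hA : ExpanA n d G α)
    (f : Fin n → Fin k → ℝ) (j : Fin k) (c : ℝ) (ℓ : ℕ)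
    (S : Finset (Fin n)) (hS : ∀ v ∈ S, f v j = c) (hne : S.Nonempty)
    (hmed : (n : ℝ) / 2 ≤ ((univ.filter fun w => f w j ≠ c).card : ℝ))
    (hl : ∀ v ∈ S, lvj G f α d v j = ℓ) :
    α * ((d : ℝ) - 1) ^ (ℓ - 1) * S.card ≤ 3 * n / 4 := by
  by_contra! hcon
  have hd1 : (0 : ℝ) < (d : ℝ) - 1 := by
    have : (3 : ℝ) ≤ d := by exact_mod_cast hd
    linarith
  have hn : (0 : ℝ) < n := by
    obtain ⟨v, _⟩ := hne
    exact_mod_cast (Nat.zero_le _).trans_lt v.2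
  have hex : ∃ r, 3 * (n : ℝ) / 4 ≤ α * ((d : ℝ) - 1) ^ r * S.card := ⟨_, hcon.le⟩
  set r := Nat.find hex with hrdef
  have hr : 3 * (n : ℝ) / 4 ≤ α * ((d : ℝ) - 1) ^ r * S.card := Nat.find_spec hex
  have hrl : r ≤ ℓ - 1 := Nat.find_min' hex hcon.le
  have hSle : (S.card : ℝ) ≤ n / 2 := by
    have h1 : S ∪ (univ.filter fun w => f w j ≠ c) ⊆ univ := Finset.subset_univ _
    have h2 : Disjoint S (univ.filter fun w => f w j ≠ c) := by
      rw [Finset.disjoint_left]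
      intro v hv hv'
      exact (Finset.mem_filter.1 hv').2 (hS v hv)
    have h3 := Finset.card_le_card h1
    rw [Finset.card_union_of_disjoint h2, Finset.card_univ, Fintype.card_fin] at h3
    have h4 : (S.card : ℝ) + ((univ.filter fun w => f w j ≠ c).card : ℝ) ≤ n := by
      exact_mod_cast h3
    linarith
  have hr1 : 1 ≤ r := by
    by_contra! h0
    have h0 : r = 0 := by omega
    rw [h0] at hr
    have : α * S.card ≤ 1 * S.card := by gcongr
    simp only [pow_zero, mul_one] at hr
    linarith
  have hmin : α * ((d : ℝ) - 1) ^ (r - 1) * S.card < 3 * n / 4 := by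
    have := Nat.find_min hex (m := r - 1) (by omega)
    exact not_le.1 this
  have hE : ∀ v ∈ S, ∀ i < r, ((jumpEdges G f j {v} (i + 1)).card : ℝ) ≤
      α * aseq (i + 1) / 6 * ((d : ℝ) - 1) ^ i := by
    intro v hv i hi
    by_contra! h
    have : lvj G f α d v j ≤ i + 1 := Nat.sInf_le ⟨by omega, by simpa using h.le⟩
    rw [hl v hv] at this
    omega
  have hcov := cover hd α hα G hreg f j c S hS hne r hr1 hE
  have hA' := hA S hne r hr1
  rw [min_eq_left hr] at hA'
  have hie := Finset.card_union_add_card_inter (univ.filter fun w => vertexSetDist G w S ≤ (r : ℕ∞))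
      (univ.filter fun w => f w j ≠ c)
  have hu : ((univ.filter fun w => vertexSetDist G w S ≤ (r : ℕ∞)) ∪
      (univ.filter fun w => f w j ≠ c)).card ≤ n := by
    simpa using Finset.card_le_univ ((univ.filter fun w => vertexSetDist G w S ≤ (r : ℕ∞)) ∪
      (univ.filter fun w => f w j ≠ c))
  have hie' := congrArg (Nat.cast (R := ℝ)) hie
  push_cast at hie'
  have hu' := (Nat.cast_le (α := ℝ)).2 hu
  linarith

lemma peel {n d : ℕ} (G : SimpleGraph (Fin n)) [DecidableRel G.Adj] (α ε L : ℝ)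
    (hε : ε ≤ 1) (hd : 3 ≤ d) (hL : 1 ≤ L)
    (hB : ExpanB n d G α ε L) (ℓ : ℕ) (hℓ : 1 ≤ ℓ)
    (E : Fin n → Finset (Sym2 (Fin n)))
    (hE : ∀ v, ∀ e ∈ E v, e ∈ G.edgeFinset ∧ edgeDist G v e ≤ ((ℓ - 1 : ℕ) : ℕ∞)) (b : ℝ)
    (V : Finset (Fin n))
    (hV : ∀ S ⊆ V, S.Nonempty → α * ((d : ℝ) - 1) ^ (ℓ - 1) * S.card ≤ 3 * n / 4)
    (hb : ∀ v ∈ V, b + L * ((d : ℝ) - 1 - ε) ^ ℓ ≤ ((E v).card : ℝ)) :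
    ∃ Et : Fin n → Finset (Sym2 (Fin n)),
      (∀ v ∈ V, Et v ⊆ E v ∧ b ≤ ((Et v).card : ℝ)) ∧
      ∀ e ∈ G.edgeFinset, ((V.filter fun v => e ∈ Et v).card : ℝ) ≤ L * ((d : ℝ) - 1 - ε) ^ ℓ := by
  have hd1 : (0 : ℝ) < (d : ℝ) - 1 - ε := by
    have : (3 : ℝ) ≤ d := by exact_mod_cast hd
    linarith
  have hK : 0 < L * ((d : ℝ) - 1 - ε) ^ ℓ := by positivity
  induction V using Finset.strongInduction with
  | H V ih =>
    rcases V.eq_empty_or_nonempty with rfl | hne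
    · exact ⟨fun _ => ∅, by simp, fun e _ => by simpa using hK.le⟩
    obtain ⟨v, hv, hvc⟩ := hB V hne ℓ hℓ (hV V subset_rfl hne)
    set H := G.edgeFinset.filter fun e => L * ((d : ℝ) - 1 - ε) ^ ℓ ≤
              ((V.filter fun u => edgeDist G u e ≤ ((ℓ - 1 : ℕ) : ℕ∞)).card : ℝ) with hH
    obtain ⟨Et, h1, h2⟩ := ih (V.erase v) (Finset.erase_ssubset hv)
      (fun S hS => hV S (hS.trans (Finset.erase_subset _ _)))
      (fun u hu => hb u (Finset.mem_of_mem_erase hu))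
    have hsub : ∀ u ∈ V, Function.update Et v (E v \ H) u ⊆ E u := by
      intro u hu
      by_cases huv : u = v
      · subst huv; simp
      · rw [Function.update_of_ne huv]
        exact (h1 u (Finset.mem_erase.2 ⟨huv, hu⟩)).1
    refine ⟨Function.update Et v (E v \ H), fun u hu => ⟨hsub u hu, ?_⟩, ?_⟩
    · by_cases huv : u = v
      · subst huv
        rw [Function.update_self]
        have h3 : E u ⊆ (E u \ H) ∪ (H.filter fun e => edgeDist G u e ≤ ((ℓ - 1 : ℕ) : ℕ∞)) := by
          intro e he
          by_cases heH : e ∈ H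
          · exact Finset.mem_union_right _ (Finset.mem_filter.2 ⟨heH, (hE u e he).2⟩)
          · exact Finset.mem_union_left _ (Finset.mem_sdiff.2 ⟨he, heH⟩)
        have h4 := (Finset.card_le_card h3).trans (Finset.card_union_le _ _)
        have h5 : ((E u).card : ℝ) ≤ ((E u \ H).card : ℝ) +
            ((H.filter fun e => edgeDist G u e ≤ ((ℓ - 1 : ℕ) : ℕ∞)).card : ℝ) := by
          exact_mod_cast h4
        have h6 := hb u hu
        linarith
      · rw [Function.update_of_ne huv]
        exact (h1 u (Finset.mem_erase.2 ⟨huv, hu⟩)).2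
    · intro e he
      by_cases hev : e ∈ E v \ H
      · have hnH := (Finset.mem_sdiff.1 hev).2
        rw [hH, Finset.mem_filter, not_and, not_le] at hnH
        refine le_trans ?_ (hnH he).le
        norm_cast
        apply Finset.card_le_card
        intro u hu
        rw [Finset.mem_filter] at hu ⊢
        exact ⟨hu.1, (hE u e (hsub u hu.1 hu.2)).2⟩
      · refine le_trans ?_ (h2 e he)
        norm_cast
        apply Finset.card_le_card
        intro u hu
        rw [Finset.mem_filter] at hu ⊢
        have huv : u ≠ v := by
          rintro rfl
          rw [Function.update_self] at hu
          exact hev hu.2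
        rw [Function.update_of_ne huv] at hu
        exact ⟨Finset.mem_erase.2 ⟨huv, hu.1⟩, hu.2⟩

lemma analytic (d L α ε : ℝ) (ℓ : ℕ) (hd : 3 ≤ d) (hα : 0 < α) (hα1 : α ≤ 1) (hε : 0 < ε)
    (hε1 : ε ≤ 1) (hL : 1 ≤ L) (hℓ : 1 ≤ ℓ)
    (h : α * aseq ℓ / 12 * (d - 1) ^ (ℓ - 1) < L * (d - 1 - ε) ^ ℓ) :
    4 * d * (d - 1) ^ (ℓ - 1) ≤ 2 * (20 * d * L / (α * ε)) ^ 8 * (d - 1 - ε) ^ ℓ := by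
  have hB : 0 < d - 1 - ε := by linarith
  have hl0 : (0 : ℝ) < ℓ := by exact_mod_cast hℓ
  have hd1 : 0 < d - 1 := by linarith
  have hBp : 0 < (d - 1 - ε) ^ ℓ := by positivity
  set ρ := (d - 1) / (d - 1 - ε) with hρ
  have hρ0 : 0 < ρ := by positivity
  set y := (ℓ : ℝ) * Real.log ρ with hy
  have hlog : ε / (d - 1) ≤ Real.log ρ := by
    have := Real.one_sub_inv_le_log_of_pos hρ0
    have h2 : 1 - ρ⁻¹ = ε / (d - 1) := by rw [hρ]; field_simp; ring
    linarith
  have hexp : ρ ^ ℓ = Real.exp y := by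
    rw [hy, Real.exp_nat_mul, Real.exp_log hρ0]
  have hAl : (d - 1) ^ ℓ = Real.exp y * (d - 1 - ε) ^ ℓ := by
    rw [← hexp, hρ, div_pow]; field_simp
  have hAl1 : (d - 1) ^ ℓ = (d - 1) ^ (ℓ - 1) * (d - 1) := by
    rw [← pow_succ]; congr 1; omega
  have hyl : (ℓ : ℝ) ≤ y * (d - 1) / ε := by
    rw [le_div_iff₀ hε, hy]
    have := mul_le_mul_of_nonneg_left hlog hl0.le
    have h3 := mul_le_mul_of_nonneg_right this hd1.le
    calc (ℓ : ℝ) * ε = ℓ * (ε / (d - 1)) * (d - 1) := by field_simp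
      _ ≤ _ := h3
  have hy0 : 0 < y := by
    have : 0 < ε / (d - 1) := by positivity
    have : 0 < Real.log ρ := by linarith
    positivity
  -- lower bound on a
  have hpi : Real.pi ^ 2 ≤ 10 := by
    have := Real.pi_lt_d2
    have := Real.pi_pos
    nlinarith
  have ha : 1 / (20 * (ℓ : ℝ) ^ 2) ≤ aseq ℓ / 12 := by
    rw [aseq]
    have : 6 / Real.pi ^ 2 * (1 / (ℓ : ℝ) ^ 2) / 12 = 1 / (2 * Real.pi ^ 2 * (ℓ : ℝ) ^ 2) := by
      field_simp; norm_num
    rw [this]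
    apply one_div_le_one_div_of_le (by positivity)
    have : 0 < (ℓ : ℝ) ^ 2 := by positivity
    nlinarith
  -- exp y < 20 ℓ² L (d-1)/α
  have h1 : α * Real.exp y < 20 * (ℓ : ℝ) ^ 2 * L * (d - 1) := by
    have h2 : α * (1 / (20 * (ℓ : ℝ) ^ 2)) * (d - 1) ^ (ℓ - 1) < L * (d - 1 - ε) ^ ℓ := by
      refine lt_of_le_of_lt ?_ h
      rw [mul_div_assoc]
      gcongr
    have h3 := mul_lt_mul_of_pos_right h2 (show 0 < 20 * (ℓ : ℝ) ^ 2 * (d - 1) by positivity)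
    have h4 : α * (1 / (20 * (ℓ : ℝ) ^ 2)) * (d - 1) ^ (ℓ - 1) * (20 * (ℓ : ℝ) ^ 2 * (d - 1)) =
        α * Real.exp y * (d - 1 - ε) ^ ℓ := by
      rw [mul_assoc α (Real.exp y), ← hAl, hAl1]; field_simp
    rw [h4] at h3
    refine lt_of_mul_lt_mul_right (a := (d - 1 - ε) ^ ℓ) ?_ hBp.le
    linarith
  set z := Real.exp (y / 2) with hz
  have hz0 : 0 < z := Real.exp_pos _
  have hzz : Real.exp y = z ^ 2 := by rw [hz, ← Real.exp_nat_mul]; congr 1; push_cast; ring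
  have hy2 : y ^ 2 ≤ 16 * z := by
    have h5 : y / 4 ≤ Real.exp (y / 4) := by linarith [Real.add_one_le_exp (y / 4)]
    have h6 : z = Real.exp (y / 4) ^ 2 := by
      rw [hz, ← Real.exp_nat_mul]; congr 1; push_cast; ring
    rw [h6]
    have : (y / 4) ^ 2 ≤ Real.exp (y / 4) ^ 2 := by gcongr
    linarith
  have hzb : z ≤ 320 * L * d ^ 3 / (α * ε ^ 2) := by
    have h7 : (ℓ : ℝ) ^ 2 ≤ 16 * z * d ^ 2 / ε ^ 2 := by
      calc (ℓ : ℝ) ^ 2 ≤ (y * (d - 1) / ε) ^ 2 := by gcongr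
        _ = y ^ 2 * (d - 1) ^ 2 / ε ^ 2 := by ring
        _ ≤ (16 * z) * d ^ 2 / ε ^ 2 := by gcongr; linarith
    have h8 : α * z ^ 2 ≤ 20 * (16 * z * d ^ 2 / ε ^ 2) * L * d := by
      rw [← hzz]
      refine h1.le.trans ?_
      gcongr
      linarith
    rw [le_div_iff₀ (by positivity)]
    have h9 : z * (z * (α * ε ^ 2)) ≤ z * (320 * L * d ^ 3) := by
      have := mul_le_mul_of_nonneg_right h8 (show 0 ≤ ε ^ 2 by positivity)
      calc z * (z * (α * ε ^ 2)) = α * z ^ 2 * ε ^ 2 := by ring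
        _ ≤ _ := this
        _ = _ := by field_simp; ring
    exact le_of_mul_le_mul_left h9 hz0
  have hfin : 4 * d * z ^ 2 ≤ 2 * (20 * d * L / (α * ε)) ^ 8 := by
    calc 4 * d * z ^ 2 ≤ 4 * d * (320 * L * d ^ 3 / (α * ε ^ 2)) ^ 2 := by gcongr
      _ = 409600 * (d ^ 7 * L ^ 2 / (α ^ 2 * ε ^ 4)) := by field_simp; ring
      _ ≤ 2 * 20 ^ 8 * (d ^ 8 * L ^ 8 / (α ^ 8 * ε ^ 8)) := by
        have hd' : 1 ≤ d := by linarith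
        have e1 : d ^ 7 ≤ d ^ 8 := pow_le_pow_right₀ hd' (by norm_num)
        have e2 : L ^ 2 ≤ L ^ 8 := pow_le_pow_right₀ hL (by norm_num)
        have e3 : α ^ 8 ≤ α ^ 2 := pow_le_pow_of_le_one hα.le hα1 (by norm_num)
        have e4 : ε ^ 8 ≤ ε ^ 4 := pow_le_pow_of_le_one hε.le hε1 (by norm_num)
        gcongr ?_ * (?_ * ?_ / (?_ * ?_))
        norm_num
      _ = _ := by field_simp
  calc 4 * d * (d - 1) ^ (ℓ - 1) ≤ 4 * d * (d - 1) ^ ℓ := by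
        have : (d - 1) ^ (ℓ - 1) ≤ (d - 1) ^ ℓ :=
          pow_le_pow_right₀ (by linarith) (by omega)
        gcongr
    _ = 4 * d * z ^ 2 * (d - 1 - ε) ^ ℓ := by rw [hAl, hzz]; ring
    _ ≤ _ := by gcongr

lemma main_aux {n d k : ℕ} (α ε L : ℝ) (hd : 3 ≤ d)
    (hα : 0 < α ∧ α ≤ 1) (hε : 0 < ε ∧ ε ≤ 1) (hL : 1 ≤ L)
    (G : SimpleGraph (Fin n)) [DecidableRel G.Adj]
    (hreg : ∀ v, G.degree v = d)
    (hExp : Expan n d G α ε L)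
    (f : Fin n → Fin k → ℝ) (j : Fin k) (c : ℝ)
    (hmed : (n : ℝ) / 2 ≤ ((univ.filter fun w => f w j ≠ c).card : ℝ))
    (ℓ : ℕ) (hℓ : 1 ≤ ℓ) (V : Finset (Fin n))
    (hV : ∀ v ∈ V, f v j = c ∧ lvj G f α d v j = ℓ) :
    ∃ Et : Fin n → Finset (Sym2 (Fin n)),
      (∀ v ∈ V, Et v ⊆ jumpEdges G f j {v} ℓ ∧
          α * aseq ℓ / 12 * ((d : ℝ) - 1) ^ (ℓ - 1) ≤ ((Et v).card : ℝ)) ∧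
      ∀ e ∈ G.edgeFinset, ((V.filter fun v => e ∈ Et v).card : ℝ) ≤
          2 * (20 * (d : ℝ) * L / (α * ε)) ^ 8 * ((d : ℝ) - 1 - ε) ^ ℓ := by
  have hd3 : (3 : ℝ) ≤ d := by exact_mod_cast hd
  have hB : 0 < (d : ℝ) - 1 - ε := by linarith [hε.2]
  have hd1 : 0 < (d : ℝ) - 1 := by linarith
  have hE : ∀ v, ∀ e ∈ jumpEdges G f j {v} ℓ,
      e ∈ G.edgeFinset ∧ edgeDist G v e ≤ ((ℓ - 1 : ℕ) : ℕ∞) := by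
    intro v e he
    simp only [jumpEdges, Finset.mem_filter, edgeSetDist, Finset.inf_singleton] at he
    exact ⟨he.1, he.2.1⟩
  have hcard : ∀ v ∈ V, α * aseq ℓ / 6 * ((d : ℝ) - 1) ^ (ℓ - 1) ≤
      ((jumpEdges G f j {v} ℓ).card : ℝ) := by
    intro v hv
    have h1 := (hV v hv).2
    have hne : {ℓ : ℕ | 1 ≤ ℓ ∧
      α * aseq ℓ / 6 * ((d : ℝ) - 1) ^ (ℓ - 1) ≤
        ((jumpEdges G f j {v} ℓ).card : ℝ)}.Nonempty := by
      rw [Set.nonempty_iff_ne_empty]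
      intro h0
      rw [lvj, h0, Nat.sInf_empty] at h1
      omega
    have h2 := Nat.sInf_mem hne
    rw [lvj] at h1
    rw [h1] at h2
    exact h2.2
  have ha : 0 ≤ aseq ℓ := by rw [aseq]; positivity
  have hα0 := hα.1
  have hpos : 0 ≤ α * aseq ℓ / 12 * ((d : ℝ) - 1) ^ (ℓ - 1) := by positivity
  by_cases hcase : α * aseq ℓ / 12 * ((d : ℝ) - 1) ^ (ℓ - 1) < L * ((d : ℝ) - 1 - ε) ^ ℓ
  · refine ⟨fun v => jumpEdges G f j {v} ℓ, fun v hv => ⟨subset_rfl, ?_⟩, fun e he => ?_⟩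
    · refine le_trans ?_ (hcard v hv)
      linarith
    · refine le_trans ?_ (analytic d L α ε ℓ hd3 hα.1 hα.2 hε.1 hε.2 hL hℓ hcase)
      have h1 : (V.filter fun v => e ∈ jumpEdges G f j {v} ℓ) ⊆
          univ.filter fun v => edgeDist G v e ≤ ((ℓ - 1 : ℕ) : ℕ∞) := by
        intro v hv
        exact Finset.mem_filter.2 ⟨Finset.mem_univ _, (hE v e (Finset.mem_filter.1 hv).2).2⟩
      have h2 := (Finset.card_le_card h1).trans (edge_ball_card hd G hreg (ℓ - 1) e)
      have hcast : ((d - 1 : ℕ) : ℝ) = (d : ℝ) - 1 := by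
        rw [Nat.cast_sub (by omega)]; simp
      rw [← hcast]
      exact_mod_cast h2
  · push Not at hcase
    obtain ⟨Et, h1, h2⟩ := peel G α ε L hε.2 hd hL hExp.2 ℓ hℓ
      (fun v => jumpEdges G f j {v} ℓ) hE (α * aseq ℓ / 12 * ((d : ℝ) - 1) ^ (ℓ - 1)) V
      (fun S hS hne => small_S hd α hα.1 hα.2 G hreg hExp.1 f j c ℓ S
        (fun v hv => (hV v (hS hv)).1) hne hmed (fun v hv => (hV v (hS hv)).2))
      (fun v hv => le_trans (by linarith) (hcard v hv))
    refine ⟨Et, h1, fun e he => (h2 e he).trans ?_⟩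
    have hε0 := hε.1
    have hM : L ≤ 20 * (d : ℝ) * L / (α * ε) := by
      rw [le_div_iff₀ (by positivity)]
      have : α * ε ≤ 1 := mul_le_one₀ hα.2 hε0.le hε.2
      nlinarith
    have hM1 : 20 * (d : ℝ) * L / (α * ε) ≤ (20 * (d : ℝ) * L / (α * ε)) ^ 8 :=
      le_self_pow₀ (hL.trans hM) (by norm_num)
    gcongr
    linarith

/-- Lemma 3.6: extraction of the nearly disjoint families `Ẽ(v, j)` of jump edges. -/
theorem stmt_10 {n d k : ℕ} (α ε L : ℝ) (hd : 3 ≤ d)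
    (hα : 0 < α ∧ α ≤ 1) (hε : 0 < ε ∧ ε ≤ 1) (hL : 1 ≤ L)
    (G : SimpleGraph (Fin n)) [DecidableRel G.Adj]
    (hreg : ∀ v, G.degree v = d)
    (hExp : Expan n d G α ε L)
    (hk : 1 ≤ k) (f : Fin n → Fin k → ℝ)
    (hval : ∀ v j, f v j = -1 ∨ f v j = 0 ∨ f v j = 1)
    (hmed : ∀ j, (n : ℝ) / 2 ≤
      min ((univ.filter fun v => 0 ≤ f v j).card : ℝ)
        ((univ.filter fun v => f v j ≤ 0).card : ℝ))
    (j : Fin k) (ℓ : ℕ) (hℓ : 1 ≤ ℓ) (s : Bool)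
    (hne : (if s then Vplus G f α d j ℓ else Vminus G f α d j ℓ).Nonempty) :
    ∃ Et : Fin n → Finset (Sym2 (Fin n)),
      (∀ v ∈ (if s then Vplus G f α d j ℓ else Vminus G f α d j ℓ),
        Et v ⊆ jumpEdges G f j {v} ℓ ∧
          α * aseq ℓ / 12 * ((d : ℝ) - 1) ^ (ℓ - 1) ≤ ((Et v).card : ℝ)) ∧
      ∀ e ∈ G.edgeFinset,
        ((((if s then Vplus G f α d j ℓ else Vminus G f α d j ℓ).filter
              fun v => e ∈ Et v).card : ℝ) ≤
          2 * (20 * (d : ℝ) * L / (α * ε)) ^ 8 * ((d : ℝ) - 1 - ε) ^ ℓ) := by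
  have hm := hmed j
  rw [le_min_iff] at hm
  cases s with
  | true =>
    simp only [if_true]
    refine main_aux α ε L hd hα hε hL G hreg hExp f j 1 (hm.2.trans ?_) ℓ hℓ _
      (fun v hv => (Finset.mem_filter.1 hv).2)
    norm_cast
    apply Finset.card_le_card
    intro w hw
    simp only [Finset.mem_filter, Finset.mem_univ, true_and] at hw ⊢
    intro h
    linarith
  | false =>
    simp only [Bool.false_eq_true, if_false]
    refine main_aux α ε L hd hα hε hL G hreg hExp f j (-1) (hm.1.trans ?_) ℓ hℓ _
      (fun v hv => (Finset.mem_filter.1 hv).2)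
    apply Nat.cast_le.2
    apply Finset.card_le_card
    intro w hw
    simp only [Finset.mem_filter, Finset.mem_univ, true_and] at hw ⊢
    intro h
    linarith
end

section
/- Let d ≥ 3 be an integer, let α, ε ∈ (0,1], L ≥ 1, and let G be a d-regular simple graph on [n] satisfying the long-range expansion property Expan(α,ε,L). Let k ≥ 1, let ‖·‖_X be a 1-unconditional norm on ℝ^k, and let f : [n] → {−1,0,1}^k satisfy min{|{v ∈ [n] : f(v)_j ≥ 0}|, |{v ∈ [n] : f(v)_j ≤ 0}|} ≥ n/2 for every j ∈ [k]. Suppose that for every v ∈ [n] and j ∈ [k] with f(v)_j ≠ 0 we are given a subset Ẽ(v,j) ⊆ E(v,j;ℓ_{v,j}) with |Ẽ(v,j)| ≥ (α·a_{ℓ_{v,j}}/12)·(d−1)^{ℓ_{v,j}−1}. Set c := α²/(48·d·(d−1)). Then for every b ∈ ℤ, every integer ℓ ≥ 1, and every v ∈ [n] with ‖χ_{J(v,ℓ)}‖_X ≥ 2^b, there exist at least c·a_ℓ·(d−1)^ℓ edges e ∈ E_G such that ‖χ_{J(v,ℓ,e)}‖_X ≥ c·a_ℓ·2^b. -/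
open Finset

attribute [local instance] Classical.propDecidable

theorem aux_parent {n : ℕ} (G : SimpleGraph (Fin n)) (v x : Fin n) (hx : x ≠ v)
    (h : G.edist v x ≠ ⊤) : ∃ p, G.Adj p x ∧ G.edist v p + 1 ≤ G.edist v x := by
  rw [SimpleGraph.edist_comm] at h
  obtain ⟨w, hw⟩ := SimpleGraph.exists_walk_of_edist_ne_top h
  cases w with
  | nil => exact absurd rfl hx
  | @cons _ p _ hadj q =>
    refine ⟨p, hadj.symm, ?_⟩
    rw [SimpleGraph.edist_comm (u := v) (v := x), ← hw, SimpleGraph.edist_comm]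
    have := SimpleGraph.edist_le q
    simp only [SimpleGraph.Walk.length_cons, Nat.cast_add, Nat.cast_one]
    gcongr

theorem edgeDist_mk {n : ℕ} (G : SimpleGraph (Fin n)) (v a b : Fin n) :
    edgeDist G v s(a, b) = min (G.edist v a) (G.edist v b) := rfl

theorem aux_step {n d : ℕ} (G : SimpleGraph (Fin n)) [DecidableRel G.Adj]
    (hreg : ∀ v, G.degree v = d) (v : Fin n) (m : ℕ) :
    (G.edgeFinset.filter fun e => edgeDist G v e ≤ ((m + 1 : ℕ) : ℕ∞)).card ≤
      d + (G.edgeFinset.filter fun e => edgeDist G v e ≤ (m : ℕ∞)).card * (d - 1) := by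
  have hp : ∀ x, ∃ p, x ≠ v → G.edist v x ≠ ⊤ → G.Adj p x ∧ G.edist v p + 1 ≤ G.edist v x := by
    intro x
    by_cases h1 : x ≠ v
    · by_cases h2 : G.edist v x ≠ ⊤
      · obtain ⟨p, h⟩ := aux_parent G v x h1 h2
        exact ⟨p, fun _ _ => h⟩
      · exact ⟨x, fun _ h => absurd h h2⟩
    · exact ⟨x, fun h => absurd h h1⟩
  choose p hp using hp
  set S : Finset (Fin n) := univ.filter fun x => x ≠ v ∧ G.edist v x ≤ ((m + 1 : ℕ) : ℕ∞) with hS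
  have hSp : ∀ x ∈ S, x ≠ v ∧ G.edist v x ≠ ⊤ ∧ G.edist v x ≤ ((m + 1 : ℕ) : ℕ∞) ∧
      G.Adj (p x) x ∧ G.edist v (p x) + 1 ≤ G.edist v x := by
    intro x hx
    have hx2 := (Finset.mem_filter.1 hx).2
    have ht : G.edist v x ≠ ⊤ := ne_top_of_le_ne_top (ENat.coe_ne_top _) hx2.2
    exact ⟨hx2.1, ht, hx2.2, hp x hx2.1 ht⟩
  have hlt : ∀ x ∈ S, G.edist v (p x) < G.edist v x := by
    intro x hx
    obtain ⟨_, ht, _, _, h⟩ := hSp x hx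
    have ht2 : G.edist v (p x) ≠ ⊤ := ne_top_of_le_ne_top ht (le_trans le_self_add h)
    exact lt_of_lt_of_le ((ENat.lt_add_one_iff ht2).2 le_rfl) h
  have hcardS : S.card ≤ (G.edgeFinset.filter fun e => edgeDist G v e ≤ (m : ℕ∞)).card := by
    apply Finset.card_le_card_of_injOn (fun x => s(p x, x))
    · intro x hx
      obtain ⟨_, ht, hle, hadj, h⟩ := hSp x hx
      simp only [Finset.coe_filter, Set.mem_setOf_eq, SimpleGraph.mem_edgeFinset,
        SimpleGraph.mem_edgeSet, edgeDist_mk]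
      refine ⟨hadj, le_trans (min_le_left _ _) ?_⟩
      have := h.trans hle
      push_cast at this
      exact (ENat.add_le_add_iff_right (by simp)).1 this
    · intro x hx y hy hxy
      simp only [Sym2.eq_iff] at hxy
      rcases hxy with h | ⟨h1, h2⟩
      · exact h.2
      · have a := hlt x hx
        have b := hlt y hy
        rw [h1] at a
        rw [← h2] at b
        exact absurd a (not_lt.2 b.le)
  have hsub : (G.edgeFinset.filter fun e => edgeDist G v e ≤ ((m + 1 : ℕ) : ℕ∞)) ⊆
      G.incidenceFinset v ∪ S.biUnion fun x => (G.incidenceFinset x).erase s(p x, x) := by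
    have key : ∀ x y, G.Adj x y → G.edist v x ≤ G.edist v y →
        G.edist v x ≤ ((m + 1 : ℕ) : ℕ∞) → s(x, y) ∈
        G.incidenceFinset v ∪ S.biUnion fun x => (G.incidenceFinset x).erase s(p x, x) := by
      intro x y hadj hxy hx
      rw [Finset.mem_union]
      by_cases hv : x = v
      · left
        subst hv
        simpa [SimpleGraph.mem_incidenceFinset, SimpleGraph.mk'_mem_incidenceSet_iff] using hadj
      · right
        have hxS : x ∈ S := by simp only [hS, Finset.mem_filter, Finset.mem_univ, true_and]; exact ⟨hv, hx⟩
        rw [Finset.mem_biUnion]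
        refine ⟨x, hxS, ?_⟩
        rw [Finset.mem_erase]
        refine ⟨?_, by simpa [SimpleGraph.mem_incidenceFinset, SimpleGraph.mk'_mem_incidenceSet_iff] using hadj⟩
        intro he
        have hl := hlt x hxS
        rw [Sym2.eq_iff] at he
        rcases he with ⟨h1, h2⟩ | ⟨h1, h2⟩
        · rw [← h1] at hl; exact lt_irrefl _ hl
        · rw [← h2] at hl; exact absurd hl (not_lt.2 hxy)
    intro e
    induction e with
    | _ x y =>
      intro he
      rw [Finset.mem_filter, SimpleGraph.mem_edgeFinset, SimpleGraph.mem_edgeSet, edgeDist_mk] at he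
      obtain ⟨hadj, hle⟩ := he
      rcases le_total (G.edist v x) (G.edist v y) with h | h
      · rw [min_eq_left h] at hle
        exact key x y hadj h hle
      · rw [min_eq_right h] at hle
        rw [Sym2.eq_swap]
        exact key y x hadj.symm h hle
  calc _ ≤ _ := Finset.card_le_card hsub
    _ ≤ _ := Finset.card_union_le _ _
    _ ≤ d + S.card * (d - 1) := by
      refine Nat.add_le_add (by rw [SimpleGraph.card_incidenceFinset_eq_degree, hreg]) ?_
      apply Finset.card_biUnion_le_card_mul
      intro x hx
      obtain ⟨_, ht, hle, hadj, h⟩ := hSp x hx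
      rw [Finset.card_erase_of_mem, SimpleGraph.card_incidenceFinset_eq_degree, hreg]
      simpa [SimpleGraph.mem_incidenceFinset, SimpleGraph.mk'_mem_incidenceSet_iff] using hadj
    _ ≤ _ := by gcongr

theorem aux_zero {n d : ℕ} (G : SimpleGraph (Fin n)) [DecidableRel G.Adj]
    (hreg : ∀ v, G.degree v = d) (v : Fin n) :
    (G.edgeFinset.filter fun e => edgeDist G v e ≤ ((0 : ℕ) : ℕ∞)).card ≤ d := by
  rw [← hreg v, ← SimpleGraph.card_incidenceFinset_eq_degree]
  apply Finset.card_le_card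
  intro e
  induction e with
  | _ x y =>
    intro he
    rw [Finset.mem_filter, SimpleGraph.mem_edgeFinset, SimpleGraph.mem_edgeSet, edgeDist_mk] at he
    obtain ⟨hadj, hle⟩ := he
    rw [SimpleGraph.mem_incidenceFinset, SimpleGraph.mk'_mem_incidenceSet_iff]
    refine ⟨hadj, ?_⟩
    simpa [min_le_iff, SimpleGraph.edist_eq_zero_iff] using hle

theorem aux_ball {n d : ℕ} (hd : 3 ≤ d) (G : SimpleGraph (Fin n)) [DecidableRel G.Adj]
    (hreg : ∀ v, G.degree v = d) (v : Fin n) (m : ℕ) :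
    (G.edgeFinset.filter fun e => edgeDist G v e ≤ (m : ℕ∞)).card + d ≤ d * (d - 1) ^ (m + 1) := by
  obtain ⟨t, rfl⟩ : ∃ t, d = t + 3 := ⟨d - 3, by omega⟩
  have e : t + 3 - 1 = t + 2 := by omega
  induction m with
  | zero =>
    have := aux_zero G hreg v
    rw [e, zero_add, pow_one]
    generalize (G.edgeFinset.filter fun e => edgeDist G v e ≤ ((0 : ℕ) : ℕ∞)).card = q at *
    nlinarith
  | succ m ih =>
    have := aux_step G hreg v m
    rw [e] at *
    rw [pow_succ]
    nlinarith

theorem aux_mono {k : ℕ} (N : (Fin k → ℝ) → ℝ) (hN : IsNorm k N) (hunc : OneUnconditional k N)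
    (x y : Fin k → ℝ) (h : ∀ j, 0 ≤ x j ∧ x j ≤ y j) : N x ≤ N y := by
  obtain ⟨_, hsm, htri⟩ := hN
  have key : ∀ s : Finset (Fin k), N (fun j => if j ∈ s then x j else y j) ≤ N y := by
    intro s
    induction s using Finset.induction_on with
    | empty => simp
    | insert i s hi ih =>
      refine le_trans ?_ ih
      set z : Fin k → ℝ := fun j => if j ∈ s then x j else y j with hz
      obtain ⟨t, ht0, ht1, ht⟩ : ∃ t : ℝ, 0 ≤ t ∧ t ≤ 1 ∧ x i = t * y i := by
        rcases (h i).1.trans (h i).2 |>.eq_or_lt with h0 | h0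
        · refine ⟨0, le_rfl, zero_le_one, ?_⟩
          have := h i
          rw [← h0] at this
          linarith [this.1, this.2]
        · exact ⟨x i / y i, div_nonneg (h i).1 h0.le, (div_le_one h0).2 (h i).2, by field_simp⟩
      set z' : Fin k → ℝ := fun j => if j = i then - z j else z j with hz'
      have hNz' : N z' = N z := by
        rw [hunc z', hunc z]
        congr 1
        funext j
        simp only [hz']
        split_ifs <;> simp
      have heq : (fun j => if j ∈ insert i s then x j else y j) =
          ((1 + t) / 2) • z + ((1 - t) / 2) • z' := by
        funext j
        simp only [Pi.add_apply, Pi.smul_apply, smul_eq_mul, hz', hz, Finset.mem_insert]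
        by_cases hji : j = i
        · subst hji
          simp only [true_or, if_true, hi, if_false]
          rw [ht]; ring
        · simp only [hji, false_or, if_false]
          ring
      rw [heq]
      refine (htri _ _).trans ?_
      rw [hsm, hsm, hNz', abs_of_nonneg (by linarith), abs_of_nonneg (by linarith)]
      apply le_of_eq
      ring
  simpa using key univ

theorem aux_sum {k : ℕ} {ι : Type*} (N : (Fin k → ℝ) → ℝ) (hN : IsNorm k N)
    (s : Finset ι) (g : ι → Fin k → ℝ) : N (∑ i ∈ s, g i) ≤ ∑ i ∈ s, N (g i) := by
  induction s using Finset.induction_on with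
  | empty => simp [(hN.1 0).2 rfl]
  | insert i s hi ih =>
    rw [Finset.sum_insert hi, Finset.sum_insert hi]
    exact (hN.2.2 _ _).trans (by gcongr)

/-- Lemma 3.9: for every vertex with large scale-`ℓ` support, many edges compensate it. -/
theorem stmt_11 {n d k : ℕ} (α ε L : ℝ) (hd : 3 ≤ d)
    (hα : 0 < α ∧ α ≤ 1) (hε : 0 < ε ∧ ε ≤ 1) (hL : 1 ≤ L)
    (G : SimpleGraph (Fin n)) [DecidableRel G.Adj]
    (hreg : ∀ v, G.degree v = d)
    (hExp : Expan n d G α ε L)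
    (hk : 1 ≤ k) (N : (Fin k → ℝ) → ℝ)
    (hN : IsNorm k N) (hunc : OneUnconditional k N)
    (f : Fin n → Fin k → ℝ)
    (hval : ∀ v j, f v j = -1 ∨ f v j = 0 ∨ f v j = 1)
    (hmed : ∀ j, (n : ℝ) / 2 ≤
      min ((univ.filter fun v => 0 ≤ f v j).card : ℝ)
        ((univ.filter fun v => f v j ≤ 0).card : ℝ))
    (Et : Fin n → Fin k → Finset (Sym2 (Fin n)))
    (hEt : ∀ v j, f v j ≠ 0 →
      Et v j ⊆ jumpEdges G f j {v} (lvj G f α d v j) ∧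
        α * aseq (lvj G f α d v j) / 12 * ((d : ℝ) - 1) ^ (lvj G f α d v j - 1) ≤
          ((Et v j).card : ℝ)) :
    ∀ (b : ℤ) (ℓ : ℕ), 1 ≤ ℓ → ∀ v : Fin n,
      (2 : ℝ) ^ b ≤ N (chi (Jset G f α d v ℓ)) →
      α ^ 2 / (48 * (d : ℝ) * ((d : ℝ) - 1)) * aseq ℓ * ((d : ℝ) - 1) ^ ℓ ≤
        ((G.edgeFinset.filter fun e =>
            α ^ 2 / (48 * (d : ℝ) * ((d : ℝ) - 1)) * aseq ℓ * (2 : ℝ) ^ b ≤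
              N (chi (JsetE G f α d Et v ℓ e))).card : ℝ) := by
  intro b ℓ hℓ v hb
  obtain ⟨hα0, hα1⟩ := hα
  set J := Jset G f α d v ℓ with hJ
  set M := N (chi J) with hM
  set c := α ^ 2 / (48 * (d : ℝ) * ((d : ℝ) - 1)) with hc
  have hdR : (3 : ℝ) ≤ d := by exact_mod_cast hd
  have h2b : (0 : ℝ) < 2 ^ b := by positivity
  have hMpos : 0 < M := lt_of_lt_of_le h2b hb
  have ha : 0 < aseq ℓ := by
    have : (0 : ℝ) < ℓ := by exact_mod_cast hℓ
    unfold aseq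
    have := Real.pi_pos
    positivity
  set B := G.edgeFinset.filter fun e => edgeDist G v e ≤ ((ℓ - 1 : ℕ) : ℕ∞) with hB
  set P : ℝ := ((d : ℝ) - 1) ^ (ℓ - 1) with hP
  have hPpos : 0 < P := by apply pow_pos; linarith
  have hPl : ((d : ℝ) - 1) ^ ℓ = P * (d - 1) := by
    rw [hP, ← pow_succ, Nat.sub_add_cancel hℓ]
  have hBcard : (B.card : ℝ) ≤ d * (P * (d - 1)) := by
    have h1 := aux_ball hd G hreg v (ℓ - 1)
    rw [Nat.sub_add_cancel hℓ] at h1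
    have h2 : B.card ≤ d * (d - 1) ^ ℓ := by
      have := Nat.le_of_add_right_le h1
      exact this
    have h3 : (B.card : ℝ) ≤ ((d * (d - 1) ^ ℓ : ℕ) : ℝ) := by exact_mod_cast h2
    rw [Nat.cast_mul, Nat.cast_pow, Nat.cast_sub (by omega), Nat.cast_one, hPl] at h3
    exact h3
  set g : Sym2 (Fin n) → ℝ := fun e => N (chi (JsetE G f α d Et v ℓ e)) with hg
  have hgM : ∀ e, g e ≤ M := by
    intro e
    apply aux_mono N hN hunc
    intro j
    have : j ∈ JsetE G f α d Et v ℓ e → j ∈ J := fun h => (Finset.mem_filter.1 h).1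
    unfold chi
    by_cases h1 : j ∈ JsetE G f α d Et v ℓ e
    · simp [h1, this h1]
    · rw [if_neg h1]
      split_ifs <;> norm_num
  have hsum : α * aseq ℓ / 12 * P * M ≤ ∑ e ∈ B, g e := by
    have hq : 0 ≤ α * aseq ℓ / 12 * P := by positivity
    calc α * aseq ℓ / 12 * P * M = N ((α * aseq ℓ / 12 * P) • chi J) := by
          rw [hN.2.1, abs_of_nonneg hq]
      _ ≤ N (∑ e ∈ B, chi (JsetE G f α d Et v ℓ e)) := by
          apply aux_mono N hN hunc
          intro j
          simp only [Pi.smul_apply, smul_eq_mul, Finset.sum_apply]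
          by_cases hj : j ∈ J
          · have hj2 := (Finset.mem_filter.1 hj).2
            obtain ⟨hs, hcard⟩ := hEt v j hj2.1
            rw [hj2.2] at hs hcard
            have e1 : chi J j = 1 := if_pos hj
            rw [e1, mul_one]
            refine ⟨hq, hcard.trans ?_⟩
            have hsB : Et v j ⊆ B := by
              intro e he
              have := Finset.mem_filter.1 (hs he)
              refine Finset.mem_filter.2 ⟨this.1, ?_⟩
              simpa [edgeSetDist] using this.2.1
            calc ((Et v j).card : ℝ) = ∑ e ∈ Et v j, chi (JsetE G f α d Et v ℓ e) j := by
                  rw [Finset.card_eq_sum_ones, Nat.cast_sum]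
                  apply Finset.sum_congr rfl
                  intro e he
                  have : j ∈ JsetE G f α d Et v ℓ e := Finset.mem_filter.2 ⟨hj, he⟩
                  simp [chi, this]
              _ ≤ _ := by
                  apply Finset.sum_le_sum_of_subset_of_nonneg hsB
                  intro e _ _
                  unfold chi
                  split_ifs <;> norm_num
          · have e1 : chi J j = 0 := if_neg hj
            rw [e1, mul_zero]
            refine ⟨le_rfl, Finset.sum_nonneg ?_⟩
            intro e _
            unfold chi
            split_ifs <;> norm_num
      _ ≤ _ := aux_sum N hN _ _
  have hc0 : 0 ≤ c := by
    apply div_nonneg (sq_nonneg _)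
    apply mul_nonneg <;> linarith
  set A := G.edgeFinset.filter fun e => c * aseq ℓ * (2 : ℝ) ^ b ≤ g e with hA
  have hup : ∑ e ∈ B, g e ≤ A.card * M + B.card * (c * aseq ℓ * M) := by
    have hle : ∀ e ∈ B, g e ≤ (if e ∈ A then M else 0) + c * aseq ℓ * M := by
      intro e he
      by_cases heA : e ∈ A
      · rw [if_pos heA]
        have : 0 ≤ c * aseq ℓ * M := by positivity
        linarith [hgM e]
      · rw [if_neg heA, zero_add]
        have h1 : ¬ (c * aseq ℓ * (2 : ℝ) ^ b ≤ g e) := fun h =>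
          heA (Finset.mem_filter.2 ⟨(Finset.mem_filter.1 he).1, h⟩)
        refine (not_le.1 h1).le.trans ?_
        gcongr
    refine (Finset.sum_le_sum hle).trans ?_
    rw [Finset.sum_add_distrib, Finset.sum_const, nsmul_eq_mul, ← Finset.sum_filter,
      Finset.sum_const, nsmul_eq_mul]
    gcongr
    intro e he
    exact (Finset.mem_filter.1 he).2
  have hfin : α * aseq ℓ / 12 * P ≤ A.card + B.card * (c * aseq ℓ) := by
    have := hsum.trans hup
    have h3 : α * aseq ℓ / 12 * P * M ≤ (A.card + B.card * (c * aseq ℓ)) * M := by linarith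
    exact le_of_mul_le_mul_right h3 hMpos
  have hB2 : B.card * (c * aseq ℓ) ≤ α ^ 2 / 48 * P * aseq ℓ := by
    have h1 : (B.card : ℝ) * (c * aseq ℓ) ≤ d * (P * (d - 1)) * (c * aseq ℓ) := by gcongr
    refine h1.trans (le_of_eq ?_)
    have : (d : ℝ) - 1 ≠ 0 := by linarith
    have : (d : ℝ) ≠ 0 := by linarith
    rw [hc]
    field_simp
  have hgoal : c * aseq ℓ * ((d : ℝ) - 1) ^ ℓ ≤ α ^ 2 / 48 * P * aseq ℓ := by
    have h1 : c * ((d : ℝ) - 1) = α ^ 2 / 48 / d := by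
      have : (d : ℝ) - 1 ≠ 0 := by linarith
      have : (d : ℝ) ≠ 0 := by linarith
      rw [hc]
      field_simp
    have h2 : α ^ 2 / 48 / d ≤ α ^ 2 / 48 := div_le_self (by positivity) (by linarith)
    calc c * aseq ℓ * ((d : ℝ) - 1) ^ ℓ = (c * ((d : ℝ) - 1)) * P * aseq ℓ := by rw [hPl]; ring
      _ ≤ _ := by rw [h1]; gcongr
  have hα2 : α ^ 2 ≤ α := by nlinarith
  have hlast : α ^ 2 / 48 * P * aseq ℓ ≤ α / 48 * P * aseq ℓ := by gcongr
  have hpp : 0 < α * (P * aseq ℓ) := by positivity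
  have : c * aseq ℓ * ((d : ℝ) - 1) ^ ℓ ≤ A.card := by linarith
  exact this
end

section
/- Let d ≥ 3 be an integer and let 0 < δ < 3/4. Set ℓ* := ⌈log_{1.0016}(3/(4δ))⌉ and γ := (1.0016/(d−1))^{ℓ*}. Let G be a d-regular simple graph on [n] with Cheeger constant h(G) ≥ 0.0048·d. Then for every A ⊆ [n] with |A| ≥ δn and every positive integer ℓ, one has |B_G(A,ℓ)| ≥ min{3n/4, γ·(d−1)^ℓ·|A|}. -/
open Finset

attribute [local instance] Classical.propDecidable

noncomputable def bll {n : ℕ} (G : SimpleGraph (Fin n)) (A : Finset (Fin n)) (k : ℕ) : Finset (Fin n) :=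
  univ.filter fun v => vertexSetDist G v A ≤ (k : ℕ∞)

lemma mem_bll {n : ℕ} (G : SimpleGraph (Fin n)) (A : Finset (Fin n)) (k : ℕ) (v : Fin n) :
    v ∈ bll G A k ↔ ∃ a ∈ A, G.edist v a ≤ (k : ℕ∞) := by
  unfold bll vertexSetDist
  rw [Finset.mem_filter, Finset.inf_le_iff (ENat.natCast_lt_top k)]
  simp

lemma bll_mono {n : ℕ} (G : SimpleGraph (Fin n)) (A : Finset (Fin n)) (k : ℕ) :
    bll G A k ⊆ bll G A (k + 1) := by
  intro v hv
  rw [mem_bll] at *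
  obtain ⟨a, ha, h⟩ := hv
  exact ⟨a, ha, h.trans (by push_cast; exact le_self_add)⟩

lemma bll_adj {n : ℕ} (G : SimpleGraph (Fin n)) (A : Finset (Fin n)) (k : ℕ) (v w : Fin n)
    (hv : v ∈ bll G A k) (h : G.Adj v w) : w ∈ bll G A (k + 1) := by
  rw [mem_bll] at *
  obtain ⟨a, ha, h'⟩ := hv
  refine ⟨a, ha, (G.edist_triangle (v := v)).trans ?_⟩
  rw [SimpleGraph.edist_eq_one_iff_adj.2 h.symm, add_comm]
  push_cast
  gcongr

lemma bdry_le {n d : ℕ} (G : SimpleGraph (Fin n)) [DecidableRel G.Adj]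
    (hreg : ∀ v, G.degree v = d) (B C F : Finset (Fin n))
    (hF : ∀ e ∈ G.edgeFinset, ∀ a b, e = s(a, b) → (a ∈ B ∧ b ∉ B ∨ b ∈ B ∧ a ∉ B) →
      a ∈ F ∨ b ∈ F) :
    (G.edgeFinset.filter fun e =>
            Sym2.lift ⟨fun a b => a ∈ B ∧ b ∉ B ∨ b ∈ B ∧ a ∉ B,
              fun a b => propext (by tauto)⟩ e).card ≤ F.card * d := by
  have : (G.edgeFinset.filter fun e =>
            Sym2.lift ⟨fun a b => a ∈ B ∧ b ∉ B ∨ b ∈ B ∧ a ∉ B,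
              fun a b => propext (by tauto)⟩ e) ⊆ F.biUnion fun v => G.incidenceFinset v := by
    intro e he
    rw [Finset.mem_filter] at he
    obtain ⟨he, hb⟩ := he
    induction e using Sym2.ind with
    | _ a b =>
      rw [Sym2.lift_mk] at hb
      rw [Finset.mem_biUnion]
      have hab : G.Adj a b := by simpa using he
      rcases hF _ he a b rfl hb with h | h
      · exact ⟨a, h, by rw [SimpleGraph.mem_incidenceFinset]; exact ⟨hab, by simp⟩⟩
      · exact ⟨b, h, by rw [SimpleGraph.mem_incidenceFinset]; exact ⟨hab, by simp⟩⟩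
  refine (Finset.card_le_card this).trans ?_
  refine Finset.card_biUnion_le_card_mul _ _ _ ?_
  intro v _
  rw [SimpleGraph.card_incidenceFinset_eq_degree, hreg]

/-- Lemma 5.6: ball growth in regular graphs with a large Cheeger constant. -/
theorem stmt_13 {n d : ℕ} (hd : 3 ≤ d) (δ : ℝ) (hδ : 0 < δ ∧ δ < 3 / 4)
    (G : SimpleGraph (Fin n)) [DecidableRel G.Adj]
    (hreg : ∀ v, G.degree v = d)
    (hCheeger : ∀ S : Finset (Fin n), S.Nonempty → 2 * S.card ≤ n →
      0.0048 * (d : ℝ) * S.card ≤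
        ((G.edgeFinset.filter fun e =>
            Sym2.lift ⟨fun a b => a ∈ S ∧ b ∉ S ∨ b ∈ S ∧ a ∉ S,
              fun a b => propext (by tauto)⟩ e).card : ℝ)) :
    ∀ A : Finset (Fin n), δ * n ≤ A.card → ∀ ℓ : ℕ, 1 ≤ ℓ →
      min (3 * (n : ℝ) / 4)
          ((1.0016 / ((d : ℝ) - 1)) ^ ⌈Real.log (3 / (4 * δ)) / Real.log 1.0016⌉ *
            ((d : ℝ) - 1) ^ ℓ * A.card) ≤
        ((univ.filter fun v => vertexSetDist G v A ≤ (ℓ : ℕ∞)).card : ℝ) := by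
  intro A hA ℓ _
  have hd' : (3 : ℝ) ≤ d := by exact_mod_cast hd
  obtain ⟨hδ0, hδ1⟩ := hδ
  change _ ≤ ((bll G A ℓ).card : ℝ)
  rcases Nat.eq_zero_or_pos n with hn | hn
  · refine (min_le_left _ _).trans ?_
    subst hn
    simp
  have hn' : (0 : ℝ) < n := by exact_mod_cast hn
  have hA0 : (0 : ℝ) < A.card := lt_of_lt_of_le (by positivity) hA
  have hA1 : A.Nonempty := Finset.card_pos.1 (by exact_mod_cast hA0)
  have hsub : ∀ k, A ⊆ bll G A k := by
    intro k a ha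
    rw [mem_bll]
    exact ⟨a, ha, by simp⟩
  have step : ∀ k, ((bll G A k).card : ℝ) ≤ 3 * n / 4 →
      1.0016 * ((bll G A k).card : ℝ) ≤ (bll G A (k + 1)).card := by
    intro k hk
    set B := bll G A k with hB
    set B' := bll G A (k + 1) with hB'
    have hss : B ⊆ B' := bll_mono G A k
    have hcard : ((B' \ B).card : ℝ) = B'.card - B.card := by
      have := Finset.card_sdiff_add_card_eq_card hss
      rw [← this]; push_cast; ring
    have hadj : ∀ v w, v ∈ B → G.Adj v w → w ∈ B' := fun v w => bll_adj G A k v w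
    by_cases h2 : 2 * B.card ≤ n
    · have h := hCheeger B (hA1.mono (hsub k)) h2
      have h3 := bdry_le G hreg B B (B' \ B) (by
        rintro e he a b rfl hab
        have hab' : G.Adj a b := by simpa using he
        simp only [Finset.mem_sdiff]
        rcases hab with ⟨h1, h2⟩ | ⟨h1, h2⟩
        · exact Or.inr ⟨hadj _ _ h1 hab', h2⟩
        · exact Or.inl ⟨hadj _ _ h1 hab'.symm, h2⟩)
      have h4 := h.trans (Nat.cast_le.2 h3)
      push_cast at h4
      rw [hcard] at h4
      have h5 : 0.0048 * (B.card : ℝ) ≤ B'.card - B.card := by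
        have : (d : ℝ) * (0.0048 * (B.card : ℝ)) ≤ d * (B'.card - B.card) := by linarith
        exact le_of_mul_le_mul_left this (by linarith)
      have : (0 : ℝ) ≤ B.card := by positivity
      linarith
    · have hc : ((Bᶜ).card : ℝ) = n - B.card := by
        have := Finset.card_compl_add_card B
        rw [Fintype.card_fin] at this
        have : ((Bᶜ.card + B.card : ℕ) : ℝ) = n := by rw [this]
        push_cast at this; linarith
      have hcn := Finset.card_compl_add_card B
      rw [Fintype.card_fin] at hcn
      have h := hCheeger Bᶜ (Finset.card_pos.1 (by
        have : (0 : ℝ) < (Bᶜ).card := by rw [hc]; linarith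
        exact_mod_cast this)) (by omega)
      have h3 := bdry_le G hreg Bᶜ B (B' \ B) (by
        rintro e he a b rfl hab
        have hab' : G.Adj a b := by simpa using he
        simp only [Finset.mem_sdiff]
        simp only [Finset.mem_compl, not_not] at hab
        rcases hab with ⟨h1, h2⟩ | ⟨h1, h2⟩
        · exact Or.inl ⟨hadj _ _ h2 hab'.symm, h1⟩
        · exact Or.inr ⟨hadj _ _ h2 hab', h1⟩)
      have h4 := h.trans (Nat.cast_le.2 h3)
      push_cast at h4
      rw [hcard, hc] at h4
      have h5 : 0.0048 * ((n : ℝ) - B.card) ≤ B'.card - B.card := by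
        have : (d : ℝ) * (0.0048 * ((n : ℝ) - B.card)) ≤ d * (B'.card - B.card) := by linarith
        exact le_of_mul_le_mul_left this (by linarith)
      linarith
  have grow : ∀ k, min (3 * (n : ℝ) / 4) (1.0016 ^ k * A.card) ≤ ((bll G A k).card : ℝ) := by
    intro k
    induction k with
    | zero =>
      refine (min_le_right _ _).trans ?_
      rw [pow_zero, one_mul]
      exact_mod_cast Finset.card_le_card (hsub 0)
    | succ k ih =>
      have hm : ((bll G A k).card : ℝ) ≤ (bll G A (k + 1)).card := by
        exact_mod_cast Finset.card_le_card (bll_mono G A k)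
      rcases le_total (3 * (n : ℝ) / 4) ((bll G A k).card : ℝ) with h | h
      · exact (min_le_left _ _).trans (h.trans hm)
      · have h1 := step k h
        rcases min_le_iff.1 ih with h2 | h2
        · exact (min_le_left _ _).trans (h2.trans hm)
        · refine (min_le_right _ _).trans ?_
          rw [pow_succ]
          linarith
  refine le_trans (le_min (min_le_left _ _) ?_) (grow ℓ)
  have hlog : (0 : ℝ) < Real.log 1.0016 := Real.log_pos (by norm_num)
  set m := ⌈Real.log (3 / (4 * δ)) / Real.log 1.0016⌉ with hm
  rcases le_or_gt m (ℓ : ℤ) with h | h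
  · refine (min_le_left _ _).trans ?_
    have h1 : Real.log (3 / (4 * δ)) / Real.log 1.0016 ≤ (ℓ : ℝ) := by
      have := Int.ceil_le.1 h
      exact_mod_cast this
    rw [div_le_iff₀ hlog, ← Real.log_pow, Real.log_le_log_iff (by positivity) (by positivity)] at h1
    calc 3 * (n : ℝ) / 4 = 3 / (4 * δ) * (δ * n) := by field_simp
      _ ≤ 1.0016 ^ ℓ * A.card := by gcongr
  · refine (min_le_right _ _).trans ?_
    gcongr
    obtain ⟨j, hj⟩ := Int.eq_ofNat_of_zero_le (sub_nonneg.2 h.le)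
    have hmj : m = ((ℓ + j : ℕ) : ℤ) := by push_cast; omega
    rw [hmj, zpow_natCast, pow_add]
    have hdp : (0 : ℝ) < (d : ℝ) - 1 := by linarith
    have e : (1.0016 / ((d : ℝ) - 1)) ^ ℓ * ((d : ℝ) - 1) ^ ℓ = 1.0016 ^ ℓ := by
      rw [← mul_pow, div_mul_cancel₀ _ hdp.ne']
    have h1 : (1.0016 / ((d : ℝ) - 1)) ^ j ≤ 1 :=
      pow_le_one₀ (by positivity) (by rw [div_le_one hdp]; linarith)
    calc _ = 1.0016 ^ ℓ * (1.0016 / ((d : ℝ) - 1)) ^ j := by rw [← e]; ring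
      _ ≤ 1.0016 ^ ℓ * 1 := by gcongr
      _ = _ := mul_one _
end
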